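/- arXiv:1903.07597 — 2 statements merged into one kernel-verified Lean document; each statement's English description precedes it below -/
import Mathlib

section
/- Let W₁, W₁', W₂, W₂', S be random variables taking values in finite types on a common probability space. If H(W₁ | W₁', S) = 0 and H(W₂ | W₂', S) = 0, then H(S) ≥ H(W₁ | W₁') + H(W₂ | W₂') − min( I(W₁; (W₂, W₂') | W₁'), I(W₂; (W₁, W₁') | W₂') ). -/
open MeasureTheory Real

/-- Shannon entropy (natural log) of a random variable `X` taking values in a
finite type, on a probability space `(Ω, μ)`:
`H(X) = -∑ₓ P(X = x) log P(X = x)`. -/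
noncomputable def entropy {Ω A : Type*} [MeasurableSpace Ω] [Fintype A]
    (μ : Measure Ω) (X : Ω → A) : ℝ :=
  ∑ x : A, Real.negMulLog ((μ (X ⁻¹' {x})).toReal)

/-- Conditional entropy `H(X | Y) = H(X, Y) - H(Y)`. -/
noncomputable def condEntropy {Ω A B : Type*} [MeasurableSpace Ω] [Fintype A] [Fintype B]
    (μ : Measure Ω) (X : Ω → A) (Y : Ω → B) : ℝ :=
  entropy μ (fun ω => (X ω, Y ω)) - entropy μ Y

/-- Conditional mutual information `I(X; Y | Z) = H(X|Z) + H(Y|Z) - H(X,Y|Z)`. -/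
noncomputable def condMutualInfo {Ω A B C : Type*} [MeasurableSpace Ω]
    [Fintype A] [Fintype B] [Fintype C]
    (μ : Measure Ω) (X : Ω → A) (Y : Ω → B) (Z : Ω → C) : ℝ :=
  condEntropy μ X Z + condEntropy μ Y Z - condEntropy μ (fun ω => (X ω, Y ω)) Z

open Classical in
/-- The law of `g ∘ V` is the push-forward of the law of `V`. -/
lemma measureReal_preimage_comp_singleton {Ω A B : Type*} [MeasurableSpace Ω] [Fintype A]
    [MeasurableSpace A] [MeasurableSingletonClass A]
    (μ : Measure Ω) [IsProbabilityMeasure μ] {V : Ω → A} (hV : Measurable V) (g : A → B) (b : B) :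
    (μ ((fun ω => g (V ω)) ⁻¹' {b})).toReal =
      ∑ v : A, if g v = b then (μ (V ⁻¹' {v})).toReal else 0 := by
  have h : (fun ω => g (V ω)) ⁻¹' {b} =
      ⋃ v ∈ Finset.univ.filter (fun v => g v = b), V ⁻¹' {v} := by
    ext ω; simp
  rw [← Finset.sum_filter, h]
  exact measureReal_biUnion_finset
    (fun i _ j _ hij => Disjoint.preimage _ (by simpa using hij))
    (fun v _ => hV (measurableSet_singleton v))

/-- The entropy of `g ∘ V` as an expectation with respect to the law of `V`. -/
lemma entropy_comp_eq_sum {Ω A B : Type*} [MeasurableSpace Ω] [Fintype A] [Fintype B]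
    [MeasurableSpace A] [MeasurableSingletonClass A]
    (μ : Measure Ω) [IsProbabilityMeasure μ] {V : Ω → A} (hV : Measurable V) (g : A → B) :
    entropy μ (fun ω => g (V ω)) =
      -∑ v : A, (μ (V ⁻¹' {v})).toReal *
        log (μ ((fun ω => g (V ω)) ⁻¹' {g v})).toReal := by
  classical
  unfold entropy Real.negMulLog
  simp_rw [neg_mul, Finset.sum_neg_distrib]
  congr 1
  have h (b : B) : (μ ((fun ω => g (V ω)) ⁻¹' {b})).toReal *
        log (μ ((fun ω => g (V ω)) ⁻¹' {b})).toReal =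
      ∑ v : A, if g v = b then (μ (V ⁻¹' {v})).toReal *
        log (μ ((fun ω => g (V ω)) ⁻¹' {b})).toReal else 0 := by
    conv_lhs => rw [measureReal_preimage_comp_singleton μ hV g b, Finset.sum_mul]
    refine Finset.sum_congr rfl fun v _ => ?_
    rw [measureReal_preimage_comp_singleton μ hV g b, ite_mul, zero_mul]
  simp_rw [h]
  rw [Finset.sum_comm]
  simp

/-- Data processing: a function of a random variable has at most its entropy. -/
lemma entropy_comp_le {Ω A B : Type*} [MeasurableSpace Ω] [Fintype A] [Fintype B]
    [MeasurableSpace A] [MeasurableSingletonClass A]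
    (μ : Measure Ω) [IsProbabilityMeasure μ] {V : Ω → A} (hV : Measurable V) (g : A → B) :
    entropy μ (fun ω => g (V ω)) ≤ entropy μ V := by
  rw [entropy_comp_eq_sum μ hV g, show entropy μ V = _ from entropy_comp_eq_sum μ hV id]
  refine neg_le_neg (Finset.sum_le_sum fun v _ => ?_)
  rcases (ENNReal.toReal_nonneg (a := μ (V ⁻¹' {v}))).eq_or_lt with h | h
  · simp [← h]
  · refine mul_le_mul_of_nonneg_left (log_le_log h ?_) h.le
    exact measureReal_mono (fun ω hω => congrArg g hω)

/-- Entropy is submodular: `H(X, Y, Z) + H(Z) ≤ H(X, Z) + H(Y, Z)`. -/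
lemma entropy_submodular {Ω A B C : Type*} [MeasurableSpace Ω]
    [Fintype A] [Fintype B] [Fintype C]
    [MeasurableSpace A] [MeasurableSingletonClass A]
    [MeasurableSpace B] [MeasurableSingletonClass B]
    [MeasurableSpace C] [MeasurableSingletonClass C]
    (μ : Measure Ω) [IsProbabilityMeasure μ] {X : Ω → A} {Y : Ω → B} {Z : Ω → C}
    (hX : Measurable X) (hY : Measurable Y) (hZ : Measurable Z) :
    entropy μ (fun ω => (X ω, Y ω, Z ω)) + entropy μ Z ≤
      entropy μ (fun ω => (X ω, Z ω)) + entropy μ (fun ω => (Y ω, Z ω)) := by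
  classical
  have hV : Measurable (fun ω => (X ω, Y ω, Z ω)) := hX.prodMk (hY.prodMk hZ)
  set V := fun ω => (X ω, Y ω, Z ω)
  set p : A × B × C → ℝ := fun v => (μ (V ⁻¹' {v})).toReal
  set q : A × C → ℝ := fun v => (μ ((fun ω => (X ω, Z ω)) ⁻¹' {v})).toReal
  set r : B × C → ℝ := fun v => (μ ((fun ω => (Y ω, Z ω)) ⁻¹' {v})).toReal
  set s : C → ℝ := fun v => (μ (Z ⁻¹' {v})).toReal
  have eV : entropy μ V = -∑ v, p v * log (p v) := entropy_comp_eq_sum μ hV id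
  have eZ : entropy μ Z = -∑ v, p v * log (s v.2.2) :=
    entropy_comp_eq_sum μ hV fun v => v.2.2
  have eXZ : entropy μ (fun ω => (X ω, Z ω)) = -∑ v, p v * log (q (v.1, v.2.2)) :=
    entropy_comp_eq_sum μ hV fun v => (v.1, v.2.2)
  have eYZ : entropy μ (fun ω => (Y ω, Z ω)) = -∑ v, p v * log (r v.2) :=
    entropy_comp_eq_sum μ hV fun v => v.2
  have q0 (v) : 0 ≤ q v := ENNReal.toReal_nonneg
  have r0 (v) : 0 ≤ r v := ENNReal.toReal_nonneg
  have s0 (v) : 0 ≤ s v := ENNReal.toReal_nonneg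
  have pq (v) : p v ≤ q (v.1, v.2.2) :=
    measureReal_mono fun ω hω => congrArg (fun v : A × B × C => (v.1, v.2.2)) hω
  have pr (v) : p v ≤ r v.2 :=
    measureReal_mono fun ω hω => congrArg (fun v : A × B × C => v.2) hω
  have ps (v) : p v ≤ s v.2.2 :=
    measureReal_mono fun ω hω => congrArg (fun v : A × B × C => v.2.2) hω
  have key (v) : p v * log (q (v.1, v.2.2)) + p v * log (r v.2) -
      p v * log (s v.2.2) - p v * log (p v) ≤ q (v.1, v.2.2) * r v.2 / s v.2.2 - p v := by
    rcases (show 0 ≤ p v from ENNReal.toReal_nonneg).eq_or_lt with h | h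
    · simp only [← h, zero_mul, add_zero, sub_zero]
      exact div_nonneg (mul_nonneg (q0 _) (r0 _)) (s0 _)
    · have hq' := h.trans_le (pq v)
      have hr' := h.trans_le (pr v)
      have hs' := h.trans_le (ps v)
      have hlog := log_le_sub_one_of_pos
        (div_pos (div_pos (mul_pos hq' hr') hs') h)
      rw [log_div (by positivity) h.ne', log_div (by positivity) hs'.ne',
        log_mul hq'.ne' hr'.ne'] at hlog
      have := mul_le_mul_of_nonneg_left hlog h.le
      rw [mul_sub _ _ (1 : ℝ), mul_div_cancel₀ _ h.ne'] at this
      linarith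
  have sumq (z) : ∑ x, q (x, z) = s z := by
    have h := measureReal_preimage_comp_singleton μ (hX.prodMk hZ) Prod.snd z
    simpa [Fintype.sum_prod_type] using h.symm
  have sumr (z) : ∑ y, r (y, z) = s z := by
    have h := measureReal_preimage_comp_singleton μ (hY.prodMk hZ) Prod.snd z
    simpa [Fintype.sum_prod_type] using h.symm
  have sump : ∑ v, p v = ∑ z, s z := by
    have h1 := measureReal_preimage_comp_singleton μ hV (fun _ => ()) ()
    have h2 := measureReal_preimage_comp_singleton μ hZ (fun _ => ()) ()
    simp only [if_true] at h1 h2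
    exact h1.symm.trans h2
  have sumqr : ∑ v : A × B × C, q (v.1, v.2.2) * r v.2 / s v.2.2 = ∑ z, s z := by
    calc ∑ v : A × B × C, q (v.1, v.2.2) * r v.2 / s v.2.2
        = ∑ z, (∑ x, q (x, z)) * (∑ y, r (y, z)) / s z := by
          simp_rw [Fintype.sum_prod_type, Finset.sum_mul_sum, Finset.sum_div]
          conv_rhs => rw [Finset.sum_comm]
          exact Finset.sum_congr rfl fun x _ => Finset.sum_comm
      _ = ∑ z, s z := by simp_rw [sumq, sumr, mul_self_div_self]
  have := Finset.sum_le_sum fun v (_ : v ∈ Finset.univ) => key v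
  simp only [Finset.sum_sub_distrib, Finset.sum_add_distrib] at this
  rw [eV, eZ, eXZ, eYZ]
  linarith

/-- If `H(W₁ | W₁', S) = 0` and `H(W₂ | W₂', S) = 0`, then
`H(S) ≥ H(W₁ | W₁') + H(W₂ | W₂') - I(W₂; W₁, W₁' | W₂')`. -/
lemma condEntropy_add_sub_condMutualInfo_le
    {Ω A₁ B₁ A₂ B₂ T : Type*} [MeasurableSpace Ω]
    [Fintype A₁] [Fintype B₁] [Fintype A₂] [Fintype B₂] [Fintype T]
    [MeasurableSpace A₁] [MeasurableSingletonClass A₁]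
    [MeasurableSpace B₁] [MeasurableSingletonClass B₁]
    [MeasurableSpace A₂] [MeasurableSingletonClass A₂]
    [MeasurableSpace B₂] [MeasurableSingletonClass B₂]
    [MeasurableSpace T] [MeasurableSingletonClass T]
    (μ : Measure Ω) [IsProbabilityMeasure μ]
    {W₁ : Ω → A₁} {W₁' : Ω → B₁} {W₂ : Ω → A₂} {W₂' : Ω → B₂} {S : Ω → T}
    (hW₁ : Measurable W₁) (hW₁' : Measurable W₁') (hW₂ : Measurable W₂)
    (hW₂' : Measurable W₂') (hS : Measurable S)
    (hdec1 : condEntropy μ W₁ (fun ω => (W₁' ω, S ω)) = 0)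
    (hdec2 : condEntropy μ W₂ (fun ω => (W₂' ω, S ω)) = 0) :
    condEntropy μ W₁ W₁' + condEntropy μ W₂ W₂' -
      condMutualInfo μ W₂ (fun ω => (W₁ ω, W₁' ω)) W₂' ≤ entropy μ S := by
  simp only [condMutualInfo, condEntropy] at *
  have hunit : entropy μ (fun _ : Ω => ()) = 0 := by simp [entropy]
  have subadd := entropy_submodular μ hS hW₁' (measurable_const (a := ()))
  have drop_S : entropy μ (fun ω => (S ω, ())) ≤ entropy μ S :=
    entropy_comp_le μ hS fun s => (s, ())
  have drop_W₁' : entropy μ (fun ω => (W₁' ω, ())) ≤ entropy μ W₁' :=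
    entropy_comp_le μ hW₁' fun b => (b, ())
  have joint : entropy μ (fun ω => (W₁' ω, S ω)) ≤ entropy μ (fun ω => (S ω, W₁' ω, ())) :=
    entropy_comp_le μ (hS.prodMk (hW₁'.prodMk measurable_const)) fun v => (v.2.1, v.1)
  have sub₁ := entropy_submodular μ hS hW₂' (hW₁.prodMk hW₁')
  have perm₁ : entropy μ (fun ω => (S ω, W₁ ω, W₁' ω)) ≤
      entropy μ (fun ω => (W₁ ω, W₁' ω, S ω)) :=
    entropy_comp_le μ (hW₁.prodMk (hW₁'.prodMk hS)) fun v => (v.2.2, v.1, v.2.1)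
  have perm₂ : entropy μ (fun ω => (W₂' ω, W₁ ω, W₁' ω)) ≤
      entropy μ (fun ω => ((W₁ ω, W₁' ω), W₂' ω)) :=
    entropy_comp_le μ ((hW₁.prodMk hW₁').prodMk hW₂') fun v => (v.2, v.1)
  have sub₂ := entropy_submodular μ hW₂ (hW₁.prodMk hW₁') (hW₂'.prodMk hS)
  have perm₃ : entropy μ (fun ω => ((W₁ ω, W₁' ω), W₂' ω, S ω)) ≤
      entropy μ (fun ω => (S ω, W₂' ω, W₁ ω, W₁' ω)) :=
    entropy_comp_le μ (hS.prodMk (hW₂'.prodMk (hW₁.prodMk hW₁')))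
      fun v => (v.2.2, v.2.1, v.1)
  have mono : entropy μ (fun ω => ((W₂ ω, W₁ ω, W₁' ω), W₂' ω)) ≤
      entropy μ (fun ω => (W₂ ω, (W₁ ω, W₁' ω), W₂' ω, S ω)) :=
    entropy_comp_le μ (hW₂.prodMk ((hW₁.prodMk hW₁').prodMk (hW₂'.prodMk hS)))
      fun v => ((v.1, v.2.1), v.2.2.1)
  linarith

/-- If `H(W₁ | W₁', S) = 0` and `H(W₂ | W₂', S) = 0`, then
`H(S) ≥ H(W₁|W₁') + H(W₂|W₂') - min( I(W₁; W₂,W₂' | W₁'), I(W₂; W₁,W₁' | W₂') )`. -/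
theorem computation_broadcast_general_converse
    {Ω A₁ B₁ A₂ B₂ T : Type*} [MeasurableSpace Ω]
    [Fintype A₁] [Fintype B₁] [Fintype A₂] [Fintype B₂] [Fintype T]
    [MeasurableSpace A₁] [MeasurableSingletonClass A₁]
    [MeasurableSpace B₁] [MeasurableSingletonClass B₁]
    [MeasurableSpace A₂] [MeasurableSingletonClass A₂]
    [MeasurableSpace B₂] [MeasurableSingletonClass B₂]
    [MeasurableSpace T] [MeasurableSingletonClass T]
    (μ : Measure Ω) [IsProbabilityMeasure μ]
    (W₁ : Ω → A₁) (W₁' : Ω → B₁) (W₂ : Ω → A₂) (W₂' : Ω → B₂) (S : Ω → T)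
    (hW₁ : Measurable W₁) (hW₁' : Measurable W₁') (hW₂ : Measurable W₂)
    (hW₂' : Measurable W₂') (hS : Measurable S)
    (hdec1 : condEntropy μ W₁ (fun ω => (W₁' ω, S ω)) = 0)
    (hdec2 : condEntropy μ W₂ (fun ω => (W₂' ω, S ω)) = 0) :
    entropy μ S ≥ condEntropy μ W₁ W₁' + condEntropy μ W₂ W₂' -
      min (condMutualInfo μ W₁ (fun ω => (W₂ ω, W₂' ω)) W₁')
        (condMutualInfo μ W₂ (fun ω => (W₁ ω, W₁' ω)) W₂') := by
  have h₁ := condEntropy_add_sub_condMutualInfo_le μ hW₁ hW₁' hW₂ hW₂' hS hdec1 hdec2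
  have h₂ := condEntropy_add_sub_condMutualInfo_le μ hW₂ hW₂' hW₁ hW₁' hS hdec2 hdec1
  rcases min_choice (condMutualInfo μ W₁ (fun ω => (W₂ ω, W₂' ω)) W₁')
    (condMutualInfo μ W₂ (fun ω => (W₁ ω, W₁' ω)) W₂') with h | h <;> rw [h] <;> linarith
end

section
/- (Single-letter converse for minimally structured matching computation broadcast.) Let m₁, m₂, m be natural numbers and let π : Fin m₁ → Fin m₂ → Equiv.Perm (Fin m) be minimally structured, meaning: for every k ≥ 2, every injective a : Fin k → Fin m₁ and injective b : Fin k → Fin m₂, the induced permutation σ = σ_{k−1} ∘ ⋯ ∘ σ₀ with σᵢ = (π (a (i+1)) (b i))⁻¹ ∘ (π (a i) (b i)) (indices cyclic in Fin k) is a derangement. Then for all functions f : Fin m₁ → Fin m and g : Fin m₂ → Fin m, the set {(p, q) ∈ Fin m₁ × Fin m₂ : g q = π p q (f p)} has cardinality at most m₁ + m₂ − 1. -/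
/-- The induced permutation `σ = σ_{k−1} ∘ ⋯ ∘ σ₁ ∘ σ₀` of a cycle described by
`a : Fin k → α`, `b : Fin k → β` (index arithmetic cyclic in `Fin k`), where
`σᵢ = (π (a (i+1)) (b i))⁻¹ ∘ (π (a i) (b i))`. -/
def inducedPerm {α β γ : Type*} (π : α → β → Equiv.Perm γ) {k : ℕ} [NeZero k]
    (a : Fin k → α) (b : Fin k → β) : Equiv.Perm γ :=
  ((List.ofFn fun i : Fin k => (π (a (i + 1)) (b i))⁻¹ * π (a i) (b i)).reverse).prod

/-- The bipartite graph on `α ⊕ β` whose edges are the pairs related by `R`. -/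
def bipartiteGraph {α β : Type*} (R : α → β → Prop) : SimpleGraph (α ⊕ β) where
  Adj u v := (∃ a b, u = Sum.inl a ∧ v = Sum.inr b ∧ R a b) ∨
    ∃ a b, u = Sum.inr b ∧ v = Sum.inl a ∧ R a b
  symm := ⟨by
    rintro u v (⟨a, b, hu, hv, h⟩ | ⟨a, b, hu, hv, h⟩)
    · exact Or.inr ⟨a, b, hv, hu, h⟩
    · exact Or.inl ⟨a, b, hv, hu, h⟩⟩
  loopless := ⟨by
    rintro u (⟨a, b, hu, hv, -⟩ | ⟨a, b, hu, hv, -⟩) <;> simp [hu] at hv⟩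

namespace bipartiteGraph

variable {α β : Type*} {R : α → β → Prop}

@[simp]
lemma adj_inl_inr {a : α} {b : β} : (bipartiteGraph R).Adj (Sum.inl a) (Sum.inr b) ↔ R a b := by
  simp [bipartiteGraph]

lemma exists_of_adj_inl {a : α} {v : α ⊕ β} (h : (bipartiteGraph R).Adj (Sum.inl a) v) :
    ∃ b, v = Sum.inr b := by
  rcases h with ⟨_, b, -, hv, -⟩ | ⟨_, b, hu, -, -⟩
  · exact ⟨b, hv⟩
  · simp at hu

lemma exists_of_adj_inr {b : β} {v : α ⊕ β} (h : (bipartiteGraph R).Adj (Sum.inr b) v) :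
    ∃ a, v = Sum.inl a := by
  rcases h with ⟨_, _, hu, -, -⟩ | ⟨a, _, -, hv, -⟩
  · simp at hu
  · exact ⟨a, hv⟩

open SimpleGraph in
/-- A cycle in a bipartite graph may be taken to start on the left. -/
lemma exists_isCycle_inl (h : ¬(bipartiteGraph R).IsAcyclic) :
    ∃ (a : α) (w : (bipartiteGraph R).Walk (Sum.inl a) (Sum.inl a)), w.IsCycle := by
  classical
  simp only [IsAcyclic, not_forall, not_not] at h
  obtain ⟨u, w, hw⟩ := h
  rcases u with a | b
  · exact ⟨a, w, hw⟩
  · obtain ⟨a, ha⟩ := exists_of_adj_inr (w.adj_snd hw.not_nil)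
    have hmem : Sum.inl a ∈ w.support := ha ▸ w.getVert_mem_support 1
    exact ⟨a, w.rotate _ hmem, hw.rotate hmem⟩

open SimpleGraph in
lemma getVert_mem_sides {a : α} {v : α ⊕ β} (w : (bipartiteGraph R).Walk (Sum.inl a) v) (i : ℕ) :
    (2 * i ≤ w.length → ∃ a', w.getVert (2 * i) = Sum.inl a') ∧
      (2 * i + 1 ≤ w.length → ∃ b, w.getVert (2 * i + 1) = Sum.inr b) := by
  have step (j : ℕ) (hj : 2 * j ≤ w.length → ∃ a', w.getVert (2 * j) = Sum.inl a')
      (hl : 2 * j + 1 ≤ w.length) : ∃ b, w.getVert (2 * j + 1) = Sum.inr b := by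
    obtain ⟨a', ha'⟩ := hj (by lia)
    exact exists_of_adj_inl (ha' ▸ w.adj_getVert_succ (by lia))
  induction i with
  | zero => exact ⟨fun _ => ⟨a, by simp⟩, step 0 fun _ => ⟨a, by simp⟩⟩
  | succ i ih =>
    have hleft (hl : 2 * (i + 1) ≤ w.length) : ∃ a', w.getVert (2 * (i + 1)) = Sum.inl a' := by
      obtain ⟨b, hb⟩ := ih.2 (by lia)
      exact exists_of_adj_inr (hb ▸ w.adj_getVert_succ (i := 2 * i + 1) (by lia))
    exact ⟨hleft, step _ hleft⟩

open SimpleGraph in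
/-- A bipartite graph with a cycle contains an alternating cycle `a₀ b₀ a₁ b₁ ⋯ aₖ = a₀` through
distinct vertices. -/
lemma exists_alternating_cycle (h : ¬(bipartiteGraph R).IsAcyclic) :
    ∃ (k : ℕ) (a : ℕ → α) (b : ℕ → β), 2 ≤ k ∧ a k = a 0 ∧ Set.InjOn a {i | i < k} ∧
      Set.InjOn b {i | i < k} ∧ ∀ i < k, R (a i) (b i) ∧ R (a (i + 1)) (b i) := by
  obtain ⟨a₀, w, hw⟩ := exists_isCycle_inl h
  have hthree := hw.three_le_length
  obtain ⟨k, hk⟩ : ∃ k, w.length = 2 * k := by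
    rcases Nat.even_or_odd' w.length with ⟨k, hk | hk⟩
    · exact ⟨k, hk⟩
    · obtain ⟨b, hb⟩ := (getVert_mem_sides w k).2 hk.ge
      rw [← hk, w.getVert_length] at hb
      simp at hb
  have hleft (i : ℕ) : ∃ a, i ≤ k → w.getVert (2 * i) = Sum.inl a := by
    by_cases hi : i ≤ k
    · obtain ⟨a, ha⟩ := (getVert_mem_sides w i).1 (by lia)
      exact ⟨a, fun _ => ha⟩
    · exact ⟨a₀, fun h => absurd h hi⟩
  obtain ⟨b₀, -⟩ := (getVert_mem_sides w 0).2 (by lia)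
  have hright (i : ℕ) : ∃ b, i < k → w.getVert (2 * i + 1) = Sum.inr b := by
    by_cases hi : i < k
    · obtain ⟨b, hb⟩ := (getVert_mem_sides w i).2 (by lia)
      exact ⟨b, fun _ => hb⟩
    · exact ⟨b₀, fun h => absurd h hi⟩
  choose a ha using hleft
  choose b hb using hright
  refine ⟨k, a, b, by lia, ?_, ?_, ?_, ?_⟩
  · have hend := ha k le_rfl
    have hstart := ha 0 (Nat.zero_le k)
    rw [← hk, w.getVert_length] at hend
    rw [Nat.mul_zero, w.getVert_zero] at hstart
    exact Sum.inl_injective (hend.symm.trans hstart)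
  · intro i (hi : i < k) j (hj : j < k) hij
    have := hw.getVert_injOn' (show 2 * i ≤ w.length - 1 by lia)
      (show 2 * j ≤ w.length - 1 by lia) (by rw [ha i hi.le, ha j hj.le, hij])
    lia
  · intro i (hi : i < k) j (hj : j < k) hij
    have := hw.getVert_injOn' (show 2 * i + 1 ≤ w.length - 1 by lia)
      (show 2 * j + 1 ≤ w.length - 1 by lia) (by rw [hb i hi, hb j hj, hij])
    lia
  · intro i hi
    have hout := w.adj_getVert_succ (i := 2 * i) (by lia)
    have hback := w.adj_getVert_succ (i := 2 * i + 1) (by lia)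
    rw [show 2 * i + 1 + 1 = 2 * (i + 1) by ring, ha (i + 1) hi, hb i hi] at hback
    rw [ha i hi.le, hb i hi] at hout
    exact ⟨adj_inl_inr.1 hout, adj_inl_inr.1 hback.symm⟩

end bipartiteGraph

/-- A finite acyclic graph on a nonempty vertex set has fewer edges than vertices. -/
lemma SimpleGraph.IsAcyclic.ncard_edgeSet_add_one_le {V : Type*} [Finite V] [Nonempty V]
    {G : SimpleGraph V} (hG : G.IsAcyclic) : G.edgeSet.ncard + 1 ≤ Nat.card V := by
  classical
  have := Fintype.ofFinite V
  obtain ⟨T, hGT, -, hT⟩ :=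
    SimpleGraph.connected_top.exists_isTree_le_of_le_of_isAcyclic (le_top (a := G)) hG
  have hcard := hT.card_edgeFinset
  rw [Nat.card_eq_fintype_card, ← hcard, ← Set.ncard_coe_finset, SimpleGraph.coe_edgeFinset]
  exact Nat.add_le_add_right
    (Set.ncard_le_ncard (SimpleGraph.edgeSet_mono hGT) (Set.toFinite _)) 1

lemma bipartiteGraph.ncard_le_of_isAcyclic {α β : Type*} [Finite α] [Finite β] {R : α → β → Prop}
    (h : (bipartiteGraph R).IsAcyclic) :
    {p : α × β | R p.1 p.2}.ncard ≤ Nat.card α + Nat.card β - 1 := by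
  rcases isEmpty_or_nonempty α with hα | hα
  · simp [Set.eq_empty_of_isEmpty]
  have hedges : {p : α × β | R p.1 p.2}.ncard ≤ (bipartiteGraph R).edgeSet.ncard := by
    refine Set.ncard_le_ncard_of_injOn (fun p => s(Sum.inl p.1, Sum.inr p.2)) ?_ ?_
      (Set.toFinite _)
    · intro p hp
      exact adj_inl_inr.2 hp
    · rintro ⟨p, q⟩ - ⟨p', q'⟩ - hpq
      simpa using hpq
  have hforest := h.ncard_edgeSet_add_one_le
  rw [Nat.card_sum] at hforest
  lia

/-- Permutations applied successively along a trajectory carry its start to its end. -/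
lemma prod_reverse_ofFn_apply {γ : Type*} {n : ℕ} (h : Fin n → Equiv.Perm γ) (x : ℕ → γ)
    (hx : ∀ i : Fin n, h i (x i) = x (i + 1)) : (List.ofFn h).reverse.prod (x 0) = x n := by
  induction n generalizing x with
  | zero => simp
  | succ n ih =>
    have h0 : h 0 (x 0) = x 1 := by simpa using hx 0
    rw [List.ofFn_succ, List.reverse_cons, List.prod_append, List.prod_singleton,
      Equiv.Perm.mul_apply, h0]
    exact ih (fun i => h i.succ) (fun i => x (i + 1)) fun i => by simpa using hx i.succ

/-- An alternating cycle of pairs consistent with `f` and `g` gives a fixed point of its induced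
permutation. -/
lemma inducedPerm_apply_eq_self {α β γ : Type*} {π : α → β → Equiv.Perm γ} {f : α → γ} {g : β → γ}
    {k : ℕ} [NeZero k] {a : ℕ → α} {b : ℕ → β} (hper : a k = a 0)
    (hab : ∀ i < k, g (b i) = π (a i) (b i) (f (a i)) ∧
      g (b i) = π (a (i + 1)) (b i) (f (a (i + 1)))) :
    inducedPerm π (fun i : Fin k => a i) (fun i : Fin k => b i) (f (a 0)) = f (a 0) := by
  have hsucc (i : Fin k) : a ((i + 1 : Fin k) : ℕ) = a (i + 1) := by
    rw [Fin.val_add, Fin.val_one', Nat.add_mod_mod]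
    rcases (Nat.succ_le_of_lt i.isLt).lt_or_eq with hi | hi
    · rw [Nat.mod_eq_of_lt hi]
    · rw [show (i : ℕ) + 1 = k from hi, Nat.mod_self, hper]
  refine (prod_reverse_ofFn_apply _ (fun i => f (a i)) fun i => ?_).trans (congrArg f hper)
  obtain ⟨hout, hback⟩ := hab i i.isLt
  beta_reduce
  rw [Equiv.Perm.mul_apply, hsucc, ← hout, hback]
  exact Equiv.symm_apply_apply _ _

/-- Single-letter converse for minimally structured matching computation
broadcast: if every cycle of `π` induces a derangement, then for arbitrary
decoding functions `f`, `g` the set of side-information pairs consistent with a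
fixed broadcast signal has at most `m₁ + m₂ − 1` elements. -/
theorem minimally_structured_consistent_pairs_bound
    {m₁ m₂ m : ℕ} (π : Fin m₁ → Fin m₂ → Equiv.Perm (Fin m))
    (hmin : ∀ (k : ℕ) (hk : 2 ≤ k) (a : Fin k → Fin m₁) (b : Fin k → Fin m₂),
      Function.Injective a → Function.Injective b →
        ∀ x : Fin m,
          (@inducedPerm (Fin m₁) (Fin m₂) (Fin m) π k ⟨by omega⟩ a b) x ≠ x)
    (f : Fin m₁ → Fin m) (g : Fin m₂ → Fin m) :
    Set.ncard {p : Fin m₁ × Fin m₂ | g p.2 = π p.1 p.2 (f p.1)} ≤ m₁ + m₂ - 1 := by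
  have hacyclic : (bipartiteGraph fun p q => g q = π p q (f p)).IsAcyclic := by
    by_contra hcycle
    obtain ⟨k, a, b, hk, hper, ha, hb, hab⟩ := bipartiteGraph.exists_alternating_cycle hcycle
    have : NeZero k := ⟨by lia⟩
    exact hmin k hk (fun i => a i) (fun i => b i)
      (fun i j hij => Fin.ext (ha i.isLt j.isLt hij))
      (fun i j hij => Fin.ext (hb i.isLt j.isLt hij)) (f (a 0)) (inducedPerm_apply_eq_self hper hab)
  simpa using bipartiteGraph.ncard_le_of_isAcyclic hacyclic
end
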